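/- Let a, b, c be real numbers with a > 0 and c > 0, and let D : ℝ⁴ → ℝ⁴ be a linear map with matrix entries d_{ij} in the standard basis (so D e_j = Σ_i d_{ij} e_i). Then D is a derivation of the Lie bracket μ_{a,b,c} if and only if d₁₂ = d₁₃ = d₁₄ = d₂₃ = d₂₄ = d₃₄ = 0, d₃₃ = d₁₁ + d₂₂, d₄₄ = 2·d₁₁ + d₂₂, and a·d₄₃ = c·d₃₂ − b·d₁₁ (the entries d₂₁, d₃₁, d₄₁, d₄₂ are not constrained). -/

import Mathlib

/-- The Lie bracket `μ_{a,b,c}` on `ℝ⁴`, determined on the standard basis by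
`[e₁,e₂] = a·e₃ + b·e₄`, `[e₁,e₃] = c·e₄` and all other brackets of basis
vectors (with `i < j`) equal to zero, extended bilinearly and antisymmetrically. -/
noncomputable def muBracket (a b c : ℝ) (x y : Fin 4 → ℝ) : Fin 4 → ℝ :=
  fun k =>
    if k = 2 then a * (x 0 * y 1 - x 1 * y 0)
    else if k = 3 then
      b * (x 0 * y 1 - x 1 * y 0) + c * (x 0 * y 2 - x 2 * y 0)
    else 0

/-- `D` is a derivation of the bracket `μ_{a,b,c}`:
`D[x,y] = [Dx,y] + [x,Dy]` for all `x, y ∈ ℝ⁴`. Here the linear map `D` is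
given by its matrix in the standard basis, so that `D e_j = ∑ i, D i j • e_i`. -/
def IsDerivation (a b c : ℝ) (D : Matrix (Fin 4) (Fin 4) ℝ) : Prop :=
  ∀ x y : Fin 4 → ℝ,
    D.mulVec (muBracket a b c x y) =
      muBracket a b c (D.mulVec x) y + muBracket a b c x (D.mulVec y)

/-- The Bach matrix `B(a,b,c)` of the nilpotent Lie group determined by `μ_{a,b,c}`. -/
noncomputable def BachMatrix (a b c : ℝ) : Matrix (Fin 4) (Fin 4) ℝ :=
  !![(1/8) * (4*a^4 + 8*a^2*b^2 - a^2*c^2 + 4*b^4 + 8*b^2*c^2 + 4*c^4), 0, 0, 0;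
     0, (1/24) * (12*a^4 + 24*a^2*b^2 - a^2*c^2 + 12*b^4 + 8*b^2*c^2 - 4*c^4),
        (2/3) * b * c * (a^2 + b^2 + c^2), 0;
     0, (2/3) * b * c * (a^2 + b^2 + c^2),
        -(1/24) * (20*a^4 - a^2*c^2 + 24*a^2*b^2 + 4*b^4 - 8*b^2*c^2 - 12*c^4),
        -(2/3) * a * b * (a^2 + b^2 + c^2);
     0, 0, -(2/3) * a * b * (a^2 + b^2 + c^2),
        (1/24) * (-4*a^4 + 3*a^2*c^2 - 8*a^2*b^2 - 20*(b^2 + c^2)^2)]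

/-- description of the derivations of `μ_{a,b,c}`. -/
theorem isDerivation_iff (a b c : ℝ) (ha : 0 < a) (hc : 0 < c)
    (D : Matrix (Fin 4) (Fin 4) ℝ) :
    IsDerivation a b c D ↔
      (D 0 1 = 0 ∧ D 0 2 = 0 ∧ D 0 3 = 0 ∧ D 1 2 = 0 ∧ D 1 3 = 0 ∧ D 2 3 = 0 ∧
        D 2 2 = D 0 0 + D 1 1 ∧ D 3 3 = 2 * D 0 0 + D 1 1 ∧
        a * D 3 2 = c * D 2 1 - b * D 0 0) := by
  constructor
  · intro h
    have h12 := h ![1, 0, 0, 0] ![0, 1, 0, 0]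
    have h13 := h ![1, 0, 0, 0] ![0, 0, 1, 0]
    have h23 := h ![0, 1, 0, 0] ![0, 0, 1, 0]
    have e120 := congrFun h12 0
    have e121 := congrFun h12 1
    have e122 := congrFun h12 2
    have e123 := congrFun h12 3
    have e130 := congrFun h13 0
    have e131 := congrFun h13 1
    have e132 := congrFun h13 2
    have e133 := congrFun h13 3
    have e233 := congrFun h23 3
    clear h h12 h13 h23
    simp [muBracket, Matrix.mulVec, dotProduct, Fin.sum_univ_four] at e120 e121 e122 e123 e130 e131 e132 e133 e233
    have hc' := hc.ne'
    have ha' := ha.ne'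
    have d03 : D 0 3 = 0 := by grind
    have d13 : D 1 3 = 0 := by grind
    have d02 : D 0 2 = 0 := by grind
    have d12 : D 1 2 = 0 := by grind
    have d23 : D 2 3 = 0 := by grind
    have d01 : D 0 1 = 0 := by grind
    have d22 : D 2 2 = D 0 0 + D 1 1 := by
      apply mul_left_cancel₀ ha'
      grind
    have d33 : D 3 3 = 2 * D 0 0 + D 1 1 := by
      apply mul_left_cancel₀ hc'
      grind
    refine ⟨d01, d02, d03, d12, d13, d23, d22, d33, ?_⟩
    grind
  · rintro ⟨d01, d02, d03, d12, d13, d23, d22, d33, d32⟩ x y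
    funext k
    fin_cases k <;>
      simp [muBracket, Matrix.mulVec, dotProduct, Fin.sum_univ_four, d01, d02, d03, d12, d13, d23, d22, d33]
    · ring
    · linear_combination (x 0 * y 1 - x 1 * y 0) * d32
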